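/- An argument ⟨Γ, Δ⟩ is (0,1]-preservation valid (every probabilistic model giving every γ ∈ Γ positive probability gives some δ ∈ Δ positive probability) if and only if it is subvaluationistically valid (for every probabilistic model, if every γ ∈ Γ is true at some world then some δ ∈ Δ is true at some world). -/

import Mathlib

/-- Propositional formulas: atoms, negation, disjunction. -/
inductive Fml : Type
  | atom : ℕ → Fml
  | neg : Fml → Fml
  | or : Fml → Fml → Fml
deriving DecidableEq

namespace Fml

def and (φ ψ : Fml) : Fml := neg (or (neg φ) (neg ψ))

def bot : Fml := and (atom 0) (neg (atom 0))

def imp (φ ψ : Fml) : Fml := or (neg φ) ψ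

def eval (v : ℕ → Bool) : Fml → Bool
  | atom n => v n
  | neg φ => !(eval v φ)
  | or φ ψ => (eval v φ) || (eval v ψ)

end Fml

/-- Two formulas are jointly classically unsatisfiable. -/
def Incompatible (φ ψ : Fml) : Prop :=
  ∀ v : ℕ → Bool, ¬(φ.eval v = true ∧ ψ.eval v = true)

/-- Classical (Set-Set) validity. -/
def ClValid (Γ Δ : Finset Fml) : Prop :=
  ∀ v : ℕ → Bool, (∀ γ ∈ Γ, γ.eval v = true) → ∃ δ ∈ Δ, δ.eval v = true

/-- Classical single-conclusion entailment. -/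
def ClEntails (Γ : Finset Fml) (φ : Fml) : Prop :=
  ∀ v : ℕ → Bool, (∀ γ ∈ Γ, γ.eval v = true) → φ.eval v = true

def ClConsistent (Γ : Finset Fml) : Prop :=
  ∃ v : ℕ → Bool, ∀ γ ∈ Γ, γ.eval v = true

def Tautology (φ : Fml) : Prop := ∀ v : ℕ → Bool, φ.eval v = true

/-- A probability distribution on formulas. -/
structure ProbDist where
  p : Fml → ℝ
  nonneg : ∀ φ, 0 ≤ p φ
  le_one : ∀ φ, p φ ≤ 1
  bot_eq : p Fml.bot = 0
  neg_eq : ∀ φ, p (Fml.neg φ) = 1 - p φ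
  add_eq : ∀ φ ψ, Incompatible φ ψ → p (Fml.or φ ψ) = p φ + p ψ

/-- A probabilistic model: worlds with classical valuations and a finitely
additive probability measure on subsets of worlds. -/
structure PModel where
  W : Type
  nonempty : Nonempty W
  val : W → ℕ → Bool
  μ : Set W → ℝ
  nonneg : ∀ A : Set W, 0 ≤ μ A
  empty_eq : μ (∅ : Set W) = 0
  univ_eq : μ (Set.univ : Set W) = 1
  add_eq : ∀ A B : Set W, Disjoint A B → μ (A ∪ B) = μ A + μ B

/-- Denotation of a formula in a model. -/
def PModel.den (M : PModel) (φ : Fml) : Set M.W := {w | φ.eval (M.val w) = true}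

/-- Induced probability of a formula in a model. -/
def PModel.prob (M : PModel) (φ : Fml) : ℝ := M.μ (M.den φ)

/-- An upset of [0,1]: contains 1, excludes 0, upward closed within [0,1]. -/
def IsUpset (α : Set ℝ) : Prop :=
  α ⊆ Set.Icc 0 1 ∧ (1 : ℝ) ∈ α ∧ (0 : ℝ) ∉ α ∧
    ∀ x ∈ α, ∀ y ∈ Set.Icc (0:ℝ) 1, x ≤ y → y ∈ α

/-- The mirror image of α. -/
def mirror (α : Set ℝ) : Set ℝ := {x ∈ Set.Icc (0:ℝ) 1 | 1 - x ∈ α}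

/-- The dual of α. -/
def dual (α : Set ℝ) : Set ℝ := Set.Icc (0:ℝ) 1 \ mirror α

/-- Conjunction of a finite set of formulas. -/
noncomputable def conj (Γ : Finset Fml) : Fml := Γ.toList.foldr Fml.and (Fml.neg Fml.bot)

/-- Disjunction of a finite set of formulas. -/
noncomputable def disj (Δ : Finset Fml) : Fml := Δ.toList.foldr Fml.or Fml.bot

/-- Disjunction of a list of formulas. -/
def disjList (l : List Fml) : Fml := l.foldr Fml.or Fml.bot

/-- α-preservation validity (over probability distributions). -/
def PresValid (α : Set ℝ) (Γ Δ : Finset Fml) : Prop :=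
  ∀ P : ProbDist, (∀ γ ∈ Γ, P.p γ ∈ α) → ∃ δ ∈ Δ, P.p δ ∈ α

/-- α-preservation validity (over probabilistic models). -/
def PresValidM (α : Set ℝ) (Γ Δ : Finset Fml) : Prop :=
  ∀ M : PModel, (∀ γ ∈ Γ, M.prob γ ∈ α) → ∃ δ ∈ Δ, M.prob δ ∈ α

/-- α-symmetric validity. -/
def SymValid (α : Set ℝ) (Γ Δ : Finset Fml) : Prop :=
  ∀ P : ProbDist, (∀ γ ∈ Γ, P.p γ ∈ α) → ∃ δ ∈ Δ, P.p δ ∉ mirror α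

/-- α-satisfiability of a finite set of formulas. -/
def Satis (α : Set ℝ) (Γ : Finset Fml) : Prop :=
  ∃ P : ProbDist, ∀ γ ∈ Γ, P.p γ ∈ α

theorem PModel.mono (M : PModel) {A B : Set M.W} (h : A ⊆ B) : M.μ A ≤ M.μ B := by
  have h1 := M.add_eq A (B \ A) Set.disjoint_sdiff_right
  rw [Set.union_sdiff_cancel h] at h1
  linarith [M.nonneg (B \ A)]

theorem PModel.union_null (M : PModel) {A B : Set M.W} (hA : M.μ A = 0) (hB : M.μ B = 0) :
    M.μ (A ∪ B) = 0 := by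
  have h1 := M.add_eq A (B \ A) Set.disjoint_sdiff_right
  rw [Set.union_sdiff_self] at h1
  have h2 := M.mono (Set.sdiff_subset : B \ A ⊆ B)
  linarith [M.nonneg (B \ A), M.nonneg (A ∪ B)]

theorem PModel.null_union (M : PModel) (Δ : Finset Fml) (h : ∀ δ ∈ Δ, M.prob δ = 0) :
    M.μ {w | ∃ δ ∈ Δ, w ∈ M.den δ} = 0 := by
  induction Δ using Finset.induction_on with
  | empty => simpa using M.empty_eq
  | insert a s ha ih =>
    have h1 := ih (fun δ hδ => h δ (Finset.mem_insert_of_mem hδ))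
    have h2 := h a (Finset.mem_insert_self a s)
    have h3 := M.union_null h2 h1
    convert h3 using 2
    ext w
    simp

theorem PModel.exists_not_null (M : PModel) {A N : Set M.W} (hA : 0 < M.μ A) (hN : M.μ N = 0) :
    ∃ w ∈ A, w ∉ N := by
  by_contra! hc
  have := M.mono (show A ⊆ N from hc)
  linarith

/-- The Dirac model on a set of worlds with given valuations. -/
noncomputable def diracModel (W : Type) (w : W) (val : W → ℕ → Bool) : PModel where
  W := W
  nonempty := ⟨w⟩
  val := val
  μ := fun A => A.indicator (fun _ => (1 : ℝ)) w
  nonneg := fun A => Set.indicator_nonneg (fun _ _ => zero_le_one) w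
  empty_eq := by simp
  univ_eq := by simp
  add_eq := fun A B h => by
    rw [Set.indicator_union_of_disjoint h]

/-- The model with worlds and valuations given, and the uniform measure along a finite family. -/
noncomputable def unifModel (W : Type) (val : W → ℕ → Bool) (ι : Type) [Fintype ι] [Nonempty ι]
    (f : ι → W) : PModel where
  W := W
  nonempty := ⟨f (Classical.arbitrary ι)⟩
  val := val
  μ := fun A => (∑ i, A.indicator (fun _ => (1 : ℝ)) (f i)) / Fintype.card ι
  nonneg := fun A => div_nonneg
    (Finset.sum_nonneg fun i _ => Set.indicator_nonneg (fun _ _ => zero_le_one) (f i)) (by positivity)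
  empty_eq := by simp
  univ_eq := by simp
  add_eq := fun A B h => by
    rw [Set.indicator_union_of_disjoint h, Finset.sum_add_distrib, add_div]

/-- (0,1]-preservation validity coincides with subvaluationist validity. -/
theorem stmt3 (Γ Δ : Finset Fml) :
    (∀ M : PModel, (∀ γ ∈ Γ, 0 < M.prob γ) → ∃ δ ∈ Δ, 0 < M.prob δ) ↔
    (∀ M : PModel, (∀ γ ∈ Γ, (M.den γ).Nonempty) → ∃ δ ∈ Δ, (M.den δ).Nonempty) := by
  constructor
  · intro H M hM
    choose g hg using hM
    obtain ⟨w0⟩ := M.nonempty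
    let f : Option Γ → M.W := fun o => o.elim w0 (fun x => g x.1 x.2)
    obtain ⟨δ, hδ, hp⟩ := H (unifModel M.W M.val (Option Γ) f) (by
      intro γ hγ
      refine div_pos (Finset.sum_pos' (fun i _ => Set.indicator_nonneg (fun _ _ => zero_le_one) _)
        ⟨some ⟨γ, hγ⟩, Finset.mem_univ _, ?_⟩) (by exact_mod_cast Fintype.card_pos)
      have h1 : (M.den γ).indicator (fun _ => (1 : ℝ)) (g γ hγ) = 1 :=
        Set.indicator_of_mem (hg γ hγ) _
      exact lt_of_lt_of_eq zero_lt_one h1.symm)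
    refine ⟨δ, hδ, ?_⟩
    by_contra hne
    rw [Set.not_nonempty_iff_eq_empty] at hne
    have : (unifModel M.W M.val (Option Γ) f).prob δ = 0 := by
      have h0 := (unifModel M.W M.val (Option Γ) f).empty_eq
      have h1 : (unifModel M.W M.val (Option Γ) f).den δ = ∅ := hne
      rw [PModel.prob, h1, h0]
    linarith
  · intro H M hM
    by_contra! hc
    have hN := M.null_union Δ (fun δ hδ => le_antisymm (hc δ hδ) (M.nonneg _))
    obtain ⟨w0, -, hw0⟩ := M.exists_not_null (A := Set.univ) (by rw [M.univ_eq]; exact zero_lt_one) hN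
    obtain ⟨δ, hδ, w, hw⟩ := H (diracModel {w : M.W // w ∉ {w | ∃ δ ∈ Δ, w ∈ M.den δ}} ⟨w0, hw0⟩
      (fun w => M.val w.1)) (by
        intro γ hγ
        obtain ⟨w, hw, hw'⟩ := M.exists_not_null (hM γ hγ) hN
        exact ⟨⟨w, hw'⟩, hw⟩)
    exact w.2 ⟨δ, hδ, hw⟩
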